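/- Let ρ and ρ' be density matrices of the same finite dimension. Suppose there exist a finite-dimensional density matrix σ, a density matrix σ' with D_J[σ'] = σ for some orthonormal basis J, and a unitary U such that U(ρ ⊗ σ)U† has marginals ρ' and σ' on the two factors, and additionally S(ρ) = S(ρ'). Then ρ and ρ' have the same spectrum, i.e. they are unitarily equivalent. -/

import Mathlib

open scoped Kronecker ComplexOrder
open Matrix

noncomputable section

/-- `ρ` is a density matrix: positive semidefinite with unit trace. -/
def IsDensityMatrix {ι : Type*} [Fintype ι] (ρ : Matrix ι ι ℂ) : Prop :=
  ρ.PosSemidef ∧ ρ.trace = 1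

/-- Partial trace over the second tensor factor. -/
def ptrace2 {ι κ : Type*} [Fintype κ] (M : Matrix (ι × κ) (ι × κ) ℂ) : Matrix ι ι ℂ :=
  Matrix.of fun i j => ∑ k, M (i, k) (j, k)

/-- Partial trace over the first tensor factor. -/
def ptrace1 {ι κ : Type*} [Fintype ι] (M : Matrix (ι × κ) (ι × κ) ℂ) : Matrix κ κ ℂ :=
  Matrix.of fun i j => ∑ k, M (k, i) (k, j)

/-- Dephasing (decoherence) channel in the fixed (standard) orthonormal basis `{|j⟩}`:
`D[σ] = ∑ j ⟨j|σ|j⟩ |j⟩⟨j|`. -/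
def deph {ι : Type*} [DecidableEq ι] (M : Matrix ι ι ℂ) : Matrix ι ι ℂ :=
  Matrix.diagonal fun j => M j j

/-- The eigenvalue list of a matrix (junk value `0` if not Hermitian). -/
def eigs {ι : Type*} [Fintype ι] [DecidableEq ι] (ρ : Matrix ι ι ℂ) : ι → ℝ :=
  if h : ρ.IsHermitian then h.eigenvalues else 0

/-- The spectrum of a matrix, as a multiset of real eigenvalues (with multiplicity). -/
def spectra {ι : Type*} [Fintype ι] [DecidableEq ι] (ρ : Matrix ι ι ℂ) : Multiset ℝ :=
  Finset.univ.val.map (eigs ρ)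

/-- von Neumann entropy `S(ρ) = -tr(ρ log ρ)`, i.e. the Shannon entropy
of the eigenvalue list (natural logarithm). -/
def vN {ι : Type*} [Fintype ι] [DecidableEq ι] (ρ : Matrix ι ι ℂ) : ℝ :=
  ∑ i, Real.negMulLog (eigs ρ i)

/-- Maximally mixed state `𝟙_d = (1/d)·I_d`. -/
def mm (d : ℕ) : Matrix (Fin d) (Fin d) ℂ :=
  (d : ℂ)⁻¹ • (1 : Matrix (Fin d) (Fin d) ℂ)

section PartialTrace

variable {ι κ : Type*} [Fintype ι] [Fintype κ]

lemma ptrace2_kronecker_conj [DecidableEq κ] (M : Matrix (ι × κ) (ι × κ) ℂ)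
    (A : Matrix ι ι ℂ) {B : Matrix κ κ ℂ} (hB : B ∈ Matrix.unitaryGroup κ ℂ) :
    ptrace2 ((A ⊗ₖ B)ᴴ * M * (A ⊗ₖ B)) = Aᴴ * ptrace2 M * A := by
  have hB' : ∀ x y, ∑ k, B x k * star (B y k) = (1 : Matrix κ κ ℂ) x y := fun x y => by
    rw [← Matrix.mem_unitaryGroup_iff.mp hB]
    simp [Matrix.mul_apply, Matrix.star_apply]
  ext i j
  simp only [ptrace2, Matrix.of_apply, Matrix.mul_apply, Matrix.conjTranspose_apply,
    Matrix.kroneckerMap_apply, Fintype.sum_prod_type, Finset.sum_mul, Finset.mul_sum, star_mul']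
  calc _ = ∑ x, ∑ y, ∑ z, ∑ w, (star (A z i) * M (z, w) (x, y) * A x j) *
        ∑ k, B y k * star (B w k) := by
        simp only [Finset.mul_sum]
        rw [Finset.sum_comm]
        refine Finset.sum_congr rfl fun x _ => ?_
        rw [Finset.sum_comm]
        refine Finset.sum_congr rfl fun y _ => ?_
        rw [Finset.sum_comm]
        refine Finset.sum_congr rfl fun z _ => ?_
        rw [Finset.sum_comm]
        refine Finset.sum_congr rfl fun w _ => Finset.sum_congr rfl fun k _ => ?_
        ring
    _ = _ := by
        simp only [hB', Matrix.one_apply, mul_ite, mul_one, mul_zero, Finset.sum_ite_eq,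
          Finset.mem_univ, if_true]
        refine Finset.sum_congr rfl fun x _ => ?_
        rw [Finset.sum_comm]

lemma ptrace1_kronecker_conj [DecidableEq ι] (M : Matrix (ι × κ) (ι × κ) ℂ)
    {A : Matrix ι ι ℂ} (hA : A ∈ Matrix.unitaryGroup ι ℂ) (B : Matrix κ κ ℂ) :
    ptrace1 ((A ⊗ₖ B)ᴴ * M * (A ⊗ₖ B)) = Bᴴ * ptrace1 M * B := by
  have h := ptrace2_kronecker_conj (M.submatrix Prod.swap Prod.swap) B hA
  have h' : ((B ⊗ₖ A)ᴴ * M.submatrix Prod.swap Prod.swap * (B ⊗ₖ A)) =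
      ((A ⊗ₖ B)ᴴ * M * (A ⊗ₖ B)).submatrix (Equiv.prodComm κ ι) (Equiv.prodComm κ ι) := by
    have hk : B ⊗ₖ A = (A ⊗ₖ B).submatrix (Equiv.prodComm κ ι) (Equiv.prodComm κ ι) := by
      ext ⟨i, j⟩ ⟨k, l⟩
      simp [mul_comm]
    rw [hk, Matrix.conjTranspose_submatrix]
    change _ * M.submatrix (Equiv.prodComm κ ι) (Equiv.prodComm κ ι) * _ = _
    rw [Matrix.submatrix_mul_equiv, Matrix.submatrix_mul_equiv]
  rw [h'] at h
  exact h

end PartialTrace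

section Diagonalization

variable {ι : Type*} [Fintype ι] [DecidableEq ι]

lemma map_val_eq_of_unitary_diag_eq {E F : Matrix ι ι ℂ} (hE : E ∈ Matrix.unitaryGroup ι ℂ)
    (hF : F ∈ Matrix.unitaryGroup ι ℂ) {a b : ι → ℝ}
    (h : E * Matrix.diagonal (fun i => (a i : ℂ)) * Eᴴ =
      F * Matrix.diagonal (fun i => (b i : ℂ)) * Fᴴ) :
    Finset.univ.val.map a = Finset.univ.val.map b := by
  have key : ∀ {E : Matrix ι ι ℂ}, E ∈ Matrix.unitaryGroup ι ℂ → ∀ a : ι → ℝ,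
      (E * Matrix.diagonal (fun i => (a i : ℂ)) * Eᴴ).charpoly.roots =
        (Finset.univ.val.map a).map Complex.ofReal := by
    intro E hE a
    have h1 : Eᴴ * E = 1 := Matrix.mem_unitaryGroup_iff'.mp hE
    rw [Matrix.charpoly_mul_comm, ← mul_assoc, h1, one_mul, Matrix.charpoly_diagonal,
      Polynomial.roots_prod _ _ (by simp [Finset.prod_ne_zero_iff, Polynomial.X_sub_C_ne_zero])]
    simp
  refine Multiset.map_injective Complex.ofReal_injective ?_
  rw [← key hE, ← key hF, h]

lemma exists_unitary_diag {A : Matrix ι ι ℂ} (hA : A.IsHermitian) :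
    ∃ E ∈ Matrix.unitaryGroup ι ℂ, A = E * Matrix.diagonal (fun i => (eigs A i : ℂ)) * Eᴴ := by
  refine ⟨hA.eigenvectorUnitary, hA.eigenvectorUnitary.2, ?_⟩
  simpa [eigs, hA, Unitary.conjStarAlgAut_apply, Matrix.star_eq_conjTranspose,
    Function.comp_def] using hA.spectral_theorem

lemma spectra_eq_of_unitary_diag {A E : Matrix ι ι ℂ} (hE : E ∈ Matrix.unitaryGroup ι ℂ)
    {a : ι → ℝ} (h : A = E * Matrix.diagonal (fun i => (a i : ℂ)) * Eᴴ) :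
    spectra A = Finset.univ.val.map a := by
  have hA : A.IsHermitian := by
    rw [h]
    refine Matrix.isHermitian_mul_mul_conjTranspose _ ?_
    exact Matrix.isHermitian_diagonal_of_self_adjoint _ (by ext; simp)
  obtain ⟨F, hF, hAF⟩ := exists_unitary_diag hA
  exact map_val_eq_of_unitary_diag_eq hF hE (hAF.symm.trans h)

lemma vN_eq_sum_map_spectra (A : Matrix ι ι ℂ) : vN A = ((spectra A).map Real.negMulLog).sum := by
  simp [vN, spectra]

lemma vN_eq_of_unitary_diag {A E : Matrix ι ι ℂ} (hE : E ∈ Matrix.unitaryGroup ι ℂ)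
    {a : ι → ℝ} (h : A = E * Matrix.diagonal (fun i => (a i : ℂ)) * Eᴴ) :
    vN A = ∑ i, Real.negMulLog (a i) := by
  rw [vN_eq_sum_map_spectra, spectra_eq_of_unitary_diag hE h]
  simp

lemma exists_unitary_conj_of_spectra_eq {A B : Matrix ι ι ℂ} (hA : A.IsHermitian)
    (hB : B.IsHermitian) (h : spectra A = spectra B) :
    ∃ V ∈ Matrix.unitaryGroup ι ℂ, B = V * A * Vᴴ := by
  have heig : eigs A = eigs B := by
    simp only [spectra, eigs, hA, hB, dif_pos] at h ⊢
    rw [Matrix.IsHermitian.eigenvalues_eq_eigenvalues_iff]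
    have h' := congrArg (Multiset.map fun x : ℝ => Polynomial.X - Polynomial.C (x : ℂ)) h
    simp only [Multiset.map_map] at h'
    rw [hA.charpoly_eq, hB.charpoly_eq]
    exact congrArg Multiset.prod h'
  obtain ⟨E, hE, hAE⟩ := exists_unitary_diag hA
  obtain ⟨F, hF, hBF⟩ := exists_unitary_diag hB
  refine ⟨F * Eᴴ, mul_mem hF (Unitary.star_mem hE), ?_⟩
  have h1 : Eᴴ * E = 1 := Matrix.mem_unitaryGroup_iff'.mp hE
  rw [Matrix.conjTranspose_mul, Matrix.conjTranspose_conjTranspose]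
  calc B = F * ((Eᴴ * E) * Matrix.diagonal (fun i => (eigs A i : ℂ)) * (Eᴴ * E)) * Fᴴ := by
        rw [h1, one_mul, mul_one, heig, ← hBF]
    _ = F * Eᴴ * (E * Matrix.diagonal (fun i => (eigs A i : ℂ)) * Eᴴ) * (E * Fᴴ) := by
        simp only [mul_assoc]
    _ = _ := by rw [← hAE]

lemma IsDensityMatrix.eigs_nonneg {A : Matrix ι ι ℂ} (hA : IsDensityMatrix A) (i : ι) :
    0 ≤ eigs A i := by
  simpa [eigs, hA.1.isHermitian] using hA.1.eigenvalues_nonneg i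

lemma IsDensityMatrix.sum_eigs {A : Matrix ι ι ℂ} (hA : IsDensityMatrix A) :
    ∑ i, eigs A i = 1 := by
  have h := hA.2.symm.trans hA.1.isHermitian.trace_eq_sum_eigenvalues
  simp only [eigs, hA.1.isHermitian, dif_pos]
  exact Complex.ofReal_injective (by simpa using h.symm)

lemma mul_diagonal_mul_conjTranspose_apply_self (G : Matrix ι ι ℂ) (a : ι → ℝ) (j : ι) :
    (G * Matrix.diagonal (fun i => (a i : ℂ)) * Gᴴ) j j =
      ((∑ i, a i * Complex.normSq (G j i) : ℝ) : ℂ) := by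
  rw [Matrix.mul_apply, Complex.ofReal_sum]
  refine Finset.sum_congr rfl fun i _ => ?_
  rw [Matrix.mul_diagonal, Matrix.conjTranspose_apply, Complex.ofReal_mul,
    ← Complex.mul_conj]
  simp only [RCLike.star_def]
  ring

lemma sum_normSq_row {G : Matrix ι ι ℂ} (hG : G ∈ Matrix.unitaryGroup ι ℂ) (j : ι) :
    ∑ i, Complex.normSq (G j i) = 1 := by
  have h1 : G * Gᴴ = 1 := Matrix.mem_unitaryGroup_iff.mp hG
  have h := mul_diagonal_mul_conjTranspose_apply_self G (fun _ => 1) j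
  simp only [Complex.ofReal_one, Matrix.diagonal_one, mul_one, h1, Matrix.one_apply_eq,
    one_mul] at h
  exact_mod_cast h.symm

lemma sum_normSq_col {G : Matrix ι ι ℂ} (hG : G ∈ Matrix.unitaryGroup ι ℂ) (i : ι) :
    ∑ j, Complex.normSq (G j i) = 1 := by
  simpa [Matrix.star_apply] using sum_normSq_row (Unitary.star_mem hG) i

end Diagonalization

section Klein

lemma negMulLog_add_mul_log_le {x y : ℝ} (hx : 0 ≤ x) (hy : 0 < y) :
    Real.negMulLog x + x * Real.log y ≤ y - x ∧
      (Real.negMulLog x + x * Real.log y = y - x → x = y) := by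
  rcases hx.eq_or_lt with rfl | hx
  · simp only [Real.negMulLog_zero, zero_mul, add_zero, sub_zero]
    exact ⟨hy.le, id⟩
  have hlog : Real.negMulLog x + x * Real.log y = x * Real.log (y / x) := by
    rw [Real.log_div hy.ne' hx.ne', Real.negMulLog]
    ring
  have hsub : y - x = x * (y / x - 1) := by
    field_simp
  rw [hlog, hsub]
  refine ⟨mul_le_mul_of_nonneg_left (Real.log_le_sub_one_of_pos (by positivity)) hx.le,
    fun h => ?_⟩
  by_contra hne
  have hlt := Real.log_lt_sub_one_of_pos (div_pos hy hx)
    (fun h1 => hne ((div_eq_one_iff_eq hx.ne').mp h1).symm)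
  exact hlt.ne (mul_left_cancel₀ hx.ne' h)

variable {ι : Type*} [Fintype ι] [DecidableEq ι]

/-- The Klein inequality with its equality case, in spectral form: `a` and `b` are the spectra of
two states and `G` is the unitary relating their eigenbases. -/
lemma klein_inequality {G : Matrix ι ι ℂ} (hG : G ∈ Matrix.unitaryGroup ι ℂ) {a b d : ι → ℝ}
    (ha : ∀ i, 0 ≤ a i) (hb : ∀ i, 0 ≤ b i) (hab : ∑ i, a i = ∑ i, b i)
    (hd : ∀ j, (G * Matrix.diagonal (fun i => (a i : ℂ)) * Gᴴ) j j = d j)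
    (hbd : ∀ j, b j = 0 → d j = 0) :
    ∑ i, Real.negMulLog (a i) ≤ -∑ j, d j * Real.log (b j) ∧
    (-∑ j, d j * Real.log (b j) ≤ ∑ i, Real.negMulLog (a i) →
      G * Matrix.diagonal (fun i => (a i : ℂ)) * Gᴴ = Matrix.diagonal fun i => (b i : ℂ)) := by
  have hd' : ∀ j, d j = ∑ i, a i * Complex.normSq (G j i) := fun j => by
    have := (hd j).symm.trans (mul_diagonal_mul_conjTranspose_apply_self G a j)
    exact_mod_cast this
  set t : ι → ι → ℝ := fun j i => Complex.normSq (G j i) *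
    (b j - a i - (Real.negMulLog (a i) + a i * Real.log (b j))) with ht
  have hcases : ∀ j i, 0 ≤ t j i ∧ (t j i = 0 → G j i = 0 ∨ a i = b j) := by
    intro j i
    rcases (hb j).eq_or_lt with hj | hj
    · have h0 : a i * Complex.normSq (G j i) = 0 := by
        refine (Finset.sum_eq_zero_iff_of_nonneg fun i _ =>
          mul_nonneg (ha i) (Complex.normSq_nonneg _)).mp ?_ i (Finset.mem_univ i)
        rw [← hd' j, hbd j hj.symm]
      rcases mul_eq_zero.mp h0 with h | h
      · simp [ht, h, ← hj]
      · have : G j i = 0 := Complex.normSq_eq_zero.mp h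
        simp [ht, this]
    · obtain ⟨hle, heq⟩ := negMulLog_add_mul_log_le (ha i) hj
      refine ⟨mul_nonneg (Complex.normSq_nonneg _) (sub_nonneg.mpr hle), fun h => ?_⟩
      rcases mul_eq_zero.mp h with h | h
      · exact Or.inl (Complex.normSq_eq_zero.mp h)
      · exact Or.inr (heq (sub_eq_zero.mp h).symm)
  have hsum : ∑ j, ∑ i, t j i =
      -∑ j, d j * Real.log (b j) - ∑ i, Real.negMulLog (a i) := by
    have e1 : ∑ j, ∑ i, Complex.normSq (G j i) * b j = ∑ j, b j := by
      simp [← Finset.sum_mul, sum_normSq_row hG]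
    have e2 : ∑ j, ∑ i, Complex.normSq (G j i) * a i = ∑ i, a i := by
      rw [Finset.sum_comm]
      simp [← Finset.sum_mul, sum_normSq_col hG]
    have e3 : ∑ j, ∑ i, Complex.normSq (G j i) * Real.negMulLog (a i) =
        ∑ i, Real.negMulLog (a i) := by
      rw [Finset.sum_comm]
      simp [← Finset.sum_mul, sum_normSq_col hG]
    have e4 : ∑ j, ∑ i, Complex.normSq (G j i) * (a i * Real.log (b j)) =
        ∑ j, d j * Real.log (b j) := by
      refine Finset.sum_congr rfl fun j _ => ?_
      rw [hd', Finset.sum_mul]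
      exact Finset.sum_congr rfl fun i _ => by ring
    simp only [ht, mul_sub, mul_add, Finset.sum_sub_distrib, Finset.sum_add_distrib,
      e1, e2, e3, e4, hab]
    ring
  have hnonneg : 0 ≤ ∑ j, ∑ i, t j i :=
    Finset.sum_nonneg fun j _ => Finset.sum_nonneg fun i _ => (hcases j i).1
  refine ⟨by linarith, fun hle => ?_⟩
  have hzero : ∑ j, ∑ i, t j i = 0 := by linarith
  have hcomm : G * Matrix.diagonal (fun i => (a i : ℂ)) =
      Matrix.diagonal (fun i => (b i : ℂ)) * G := by
    ext j i
    rw [Matrix.mul_diagonal, Matrix.diagonal_mul]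
    have hj := (Finset.sum_eq_zero_iff_of_nonneg fun j _ =>
      Finset.sum_nonneg fun i _ => (hcases j i).1).mp hzero j (Finset.mem_univ j)
    have hi := (Finset.sum_eq_zero_iff_of_nonneg fun i _ => (hcases j i).1).mp hj i
      (Finset.mem_univ i)
    rcases (hcases j i).2 hi with h | h
    · simp [h]
    · rw [h, mul_comm]
  have h1 : G * Gᴴ = 1 := Matrix.mem_unitaryGroup_iff.mp hG
  rw [hcomm, mul_assoc, h1, mul_one]

/-- Subadditivity of entropy in spectral form, with its equality case: `p` and `q` are the
marginals, in product eigenbasis, of a state with spectrum `a`. -/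
lemma subadditivity_of_marginals {κ : Type*} [Fintype κ] [DecidableEq κ]
    {G : Matrix (ι × κ) (ι × κ) ℂ} (hG : G ∈ Matrix.unitaryGroup (ι × κ) ℂ)
    {a : ι × κ → ℝ} {p : ι → ℝ} {q : κ → ℝ} (ha : ∀ x, 0 ≤ a x) (hp1 : ∑ i, p i = 1)
    (hq1 : ∑ j, q j = 1) (ha1 : ∑ x, a x = 1)
    (hp : ptrace2 (G * Matrix.diagonal (fun x => (a x : ℂ)) * Gᴴ) =
      Matrix.diagonal fun i => (p i : ℂ))
    (hq : ptrace1 (G * Matrix.diagonal (fun x => (a x : ℂ)) * Gᴴ) =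
      Matrix.diagonal fun j => (q j : ℂ))
    (hle : ∑ i, Real.negMulLog (p i) + ∑ j, Real.negMulLog (q j) ≤
      ∑ x, Real.negMulLog (a x)) :
    G * Matrix.diagonal (fun x => (a x : ℂ)) * Gᴴ =
      Matrix.diagonal fun x => ((p x.1 * q x.2 : ℝ) : ℂ) := by
  set d : ι × κ → ℝ := fun x => ∑ y, a y * Complex.normSq (G x y) with hd
  have hdG := mul_diagonal_mul_conjTranspose_apply_self G a
  have hd0 : ∀ x, 0 ≤ d x := fun x =>
    Finset.sum_nonneg fun y _ => mul_nonneg (ha y) (Complex.normSq_nonneg _)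
  have hdp : ∀ i, ∑ j, d (i, j) = p i := fun i => by
    have h := congrFun (congrFun hp i) i
    simp only [ptrace2, Matrix.of_apply, hdG, Matrix.diagonal_apply_eq] at h
    exact_mod_cast h
  have hdq : ∀ j, ∑ i, d (i, j) = q j := fun j => by
    have h := congrFun (congrFun hq j) j
    simp only [ptrace1, Matrix.of_apply, hdG, Matrix.diagonal_apply_eq] at h
    exact_mod_cast h
  have hp0 : ∀ i, 0 ≤ p i := fun i => hdp i ▸ Finset.sum_nonneg fun j _ => hd0 _
  have hq0 : ∀ j, 0 ≤ q j := fun j => hdq j ▸ Finset.sum_nonneg fun i _ => hd0 _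
  have hpd : ∀ i j, p i = 0 → d (i, j) = 0 := fun i j h =>
    (Finset.sum_eq_zero_iff_of_nonneg fun j _ => hd0 (i, j)).mp ((hdp i).trans h) j
      (Finset.mem_univ j)
  have hqd : ∀ i j, q j = 0 → d (i, j) = 0 := fun i j h =>
    (Finset.sum_eq_zero_iff_of_nonneg fun i _ => hd0 (i, j)).mp ((hdq j).trans h) i
      (Finset.mem_univ i)
  refine (klein_inequality hG (b := fun x => p x.1 * q x.2) (d := d) ha
    (fun x => mul_nonneg (hp0 _) (hq0 _)) ?_ hdG ?_).2 ?_
  · rw [ha1, Fintype.sum_prod_type]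
    simp [← Finset.mul_sum, hp1, hq1]
  · rintro ⟨i, j⟩ h
    exact (mul_eq_zero.mp h).elim (hpd i j) (hqd i j)
  · have hlog : ∀ i j, d (i, j) * Real.log (p i * q j) =
        d (i, j) * Real.log (p i) + d (i, j) * Real.log (q j) := fun i j => by
      by_cases h1 : p i = 0
      · simp [hpd i j h1]
      by_cases h2 : q j = 0
      · simp [hqd i j h2]
      rw [Real.log_mul h1 h2, mul_add]
    have e : ∑ x : ι × κ, d x * Real.log (p x.1 * q x.2) =
        ∑ i, p i * Real.log (p i) + ∑ j, q j * Real.log (q j) := by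
      simp only [Fintype.sum_prod_type, hlog, Finset.sum_add_distrib, ← Finset.sum_mul, hdp]
      congr 1
      rw [Finset.sum_comm]
      simp only [← Finset.sum_mul, hdq]
    simp only [Real.negMulLog, neg_mul, Finset.sum_neg_distrib] at hle
    simp only [e, Real.negMulLog, neg_mul, Finset.sum_neg_distrib]
    linarith

end Klein

section Multisets

lemma Multiset.eq_of_sum_map_eval_eq {K : Type*} [Field K] [CharZero K] {s t : Multiset K}
    (h : ∀ f : Polynomial K, (s.map fun x => f.eval x).sum = (t.map fun x => f.eval x).sum) :
    s = t := by
  classical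
  ext x
  set f : Polynomial K :=
    ∏ y ∈ (s + t).toFinset.erase x, (Polynomial.X - Polynomial.C y) with hf
  have hfx : f.eval x ≠ 0 := by
    rw [hf, Polynomial.eval_prod, Finset.prod_ne_zero_iff]
    intro y hy
    simpa [sub_eq_zero] using (Finset.ne_of_mem_erase hy).symm
  have hfy : ∀ y ∈ s + t, y ≠ x → f.eval y = 0 := fun y hy hne => by
    rw [hf, Polynomial.eval_prod]
    exact Finset.prod_eq_zero (Finset.mem_erase.mpr ⟨hne, Multiset.mem_toFinset.mpr hy⟩)
      (by simp)
  have key : ∀ u : Multiset K, u ≤ s + t →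
      (u.map fun y => f.eval y).sum = u.count x * f.eval x := by
    intro u hu
    rw [Finset.sum_multiset_map_count, Finset.sum_eq_single x]
    · simp
    · intro y hy hne
      rw [hfy y (Multiset.mem_of_le hu (Multiset.mem_toFinset.mp hy)) hne, smul_zero]
    · intro hx
      simp [Multiset.count_eq_zero.mpr (fun h => hx (Multiset.mem_toFinset.mpr h))]
  have := h f
  rw [key s (Multiset.le_add_right _ _), key t (Multiset.le_add_left _ _)] at this
  exact_mod_cast mul_right_cancel₀ hfx this

lemma Multiset.eq_of_sum_map_pow_eq {K : Type*} [Field K] [CharZero K] {s t : Multiset K}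
    (h : ∀ N : ℕ, (s.map (· ^ N)).sum = (t.map (· ^ N)).sum) : s = t := by
  refine Multiset.eq_of_sum_map_eval_eq fun f => ?_
  have key : ∀ u : Multiset K, (u.map fun x => f.eval x).sum =
      ∑ N ∈ f.support, f.coeff N * (u.map (· ^ N)).sum := by
    intro u
    induction u using Multiset.induction with
    | empty => simp
    | cons x u ih =>
      simp only [Multiset.map_cons, Multiset.sum_cons, ih, mul_add, Finset.sum_add_distrib]
      rw [Polynomial.eval_eq_sum, Polynomial.sum_def]
  simp only [key, h]

/-- Cancellation of a common nonnegative factor from products of real families. -/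
lemma map_val_eq_of_map_mul_eq {ι κ : Type*} [Fintype ι] [Fintype κ] {a b : ι → ℝ}
    {c c' : κ → ℝ} (hc : ∀ j, 0 ≤ c j) (hc1 : ∑ j, c j = 1)
    (hcc : Finset.univ.val.map c = Finset.univ.val.map c')
    (h : (Finset.univ : Finset (ι × κ)).val.map (fun x => a x.1 * c x.2) =
      (Finset.univ : Finset (ι × κ)).val.map (fun x => b x.1 * c' x.2)) :
    Finset.univ.val.map a = Finset.univ.val.map b := by
  refine Multiset.eq_of_sum_map_pow_eq fun N => ?_
  have h1 := congrArg (fun u : Multiset ℝ => (u.map (· ^ N)).sum) h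
  have h2 := congrArg (fun u : Multiset ℝ => (u.map (· ^ N)).sum) hcc
  simp only [Multiset.map_map, Function.comp_def] at h1 h2 ⊢
  change ∑ x : ι × κ, (a x.1 * c x.2) ^ N = ∑ x : ι × κ, (b x.1 * c' x.2) ^ N at h1
  change ∑ j, c j ^ N = ∑ j, c' j ^ N at h2
  change ∑ i, a i ^ N = ∑ i, b i ^ N
  simp only [Fintype.sum_prod_type, mul_pow, ← Finset.mul_sum, ← Finset.sum_mul, ← h2] at h1
  refine mul_right_cancel₀ (ne_of_gt ?_) h1
  obtain ⟨j, -, hj⟩ := Finset.exists_ne_zero_of_sum_ne_zero (hc1.trans_ne one_ne_zero)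
  exact Finset.sum_pos' (fun j _ => pow_nonneg (hc j) N)
    ⟨j, Finset.mem_univ j, pow_pos ((hc j).lt_of_ne' hj) N⟩

end Multisets

/-- Suppose `U(ρ ⊗ σ)U†` has marginals `ρ'` and `σ'`, where `σ` is the
dephasing of `σ'` in some orthonormal basis `J` (given by the columns of a unitary `W`),
and `S(ρ) = S(ρ')`. Then `ρ` and `ρ'` have the same spectrum, i.e. they are unitarily
equivalent. -/
theorem stmt18 {n m : ℕ} (ρ ρ' : Matrix (Fin n) (Fin n) ℂ)
    (σ σ' : Matrix (Fin m) (Fin m) ℂ)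
    (hρ : IsDensityMatrix ρ) (hρ' : IsDensityMatrix ρ')
    (hσ : IsDensityMatrix σ) (hσ' : IsDensityMatrix σ')
    (W : Matrix (Fin m) (Fin m) ℂ) (hW : W ∈ Matrix.unitaryGroup (Fin m) ℂ)
    (hdeph : σ = W * deph (Wᴴ * σ' * W) * Wᴴ)
    (U : Matrix (Fin n × Fin m) (Fin n × Fin m) ℂ)
    (hU : U ∈ Matrix.unitaryGroup (Fin n × Fin m) ℂ)
    (h1 : ptrace2 (U * (ρ ⊗ₖ σ) * Uᴴ) = ρ')
    (h2 : ptrace1 (U * (ρ ⊗ₖ σ) * Uᴴ) = σ')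
    (hS : vN ρ = vN ρ') :
    spectra ρ = spectra ρ' ∧
    ∃ V ∈ Matrix.unitaryGroup (Fin n) ℂ, ρ' = V * ρ * Vᴴ := by
  have hW1 : Wᴴ * W = 1 := Matrix.mem_unitaryGroup_iff'.mp hW
  have hW2 : W * Wᴴ = 1 := Matrix.mem_unitaryGroup_iff.mp hW
  obtain ⟨R, hR, hρR⟩ := exists_unitary_diag hρ.1.isHermitian
  obtain ⟨R', hR', hρR'⟩ := exists_unitary_diag hρ'.1.isHermitian
  obtain ⟨Q, hQ, hσQ⟩ := exists_unitary_diag hσ'.1.isHermitian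
  have hR'1 : R'ᴴ * R' = 1 := Matrix.mem_unitaryGroup_iff'.mp hR'
  have hQ1 : Qᴴ * Q = 1 := Matrix.mem_unitaryGroup_iff'.mp hQ
  set r := eigs ρ with hr
  set p := eigs ρ' with hp
  set q := eigs σ' with hq
  set H := Wᴴ * Q with hH
  have hHmem : H ∈ Matrix.unitaryGroup (Fin m) ℂ := mul_mem (Unitary.star_mem hW) hQ
  have hHσ : Wᴴ * σ' * W = H * Matrix.diagonal (fun i => (q i : ℂ)) * Hᴴ := by
    rw [hσQ, hH, Matrix.conjTranspose_mul, Matrix.conjTranspose_conjTranspose]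
    simp only [mul_assoc]
  set s : Fin m → ℝ := fun j => ∑ i, q i * Complex.normSq (H j i) with hs
  have hHs := mul_diagonal_mul_conjTranspose_apply_self H q
  have hs0 : ∀ j, 0 ≤ s j := fun j =>
    Finset.sum_nonneg fun i _ => mul_nonneg (hσ'.eigs_nonneg i) (Complex.normSq_nonneg _)
  have hs1 : ∑ j, s j = 1 := by
    rw [hs, Finset.sum_comm]
    simp only [← Finset.mul_sum, sum_normSq_col hHmem, mul_one]
    exact hσ'.sum_eigs
  have hσs : σ = W * Matrix.diagonal (fun j => (s j : ℂ)) * Wᴴ := by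
    rw [hdeph, deph, hHσ]
    simp only [hHs, hs]
  have hvσ := vN_eq_of_unitary_diag hW hσs
  obtain ⟨hdephle, hdepheq⟩ := klein_inequality hHmem hσ'.eigs_nonneg hs0
    (hσ'.sum_eigs.trans hs1.symm) hHs (fun _ h => h)
  have hcross : -∑ j, s j * Real.log (s j) = vN σ := by
    rw [hvσ]
    simp [Real.negMulLog]
  change vN σ' ≤ -∑ j, s j * Real.log (s j) at hdephle
  change -∑ j, s j * Real.log (s j) ≤ vN σ' → _ at hdepheq
  rw [hcross] at hdephle hdepheq
  set G := (R' ⊗ₖ Q)ᴴ * U * (R ⊗ₖ W) with hGdef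
  have hF : R' ⊗ₖ Q ∈ Matrix.unitaryGroup (Fin n × Fin m) ℂ :=
    Matrix.kronecker_mem_unitary hR' hQ
  have hG : G ∈ Matrix.unitaryGroup (Fin n × Fin m) ℂ :=
    mul_mem (mul_mem (Unitary.star_mem hF) hU) (Matrix.kronecker_mem_unitary hR hW)
  set a : Fin n × Fin m → ℝ := fun x => r x.1 * s x.2 with ha
  have hrs : ρ ⊗ₖ σ = (R ⊗ₖ W) * Matrix.diagonal (fun x => (a x : ℂ)) * (R ⊗ₖ W)ᴴ := by
    have hdiag : Matrix.diagonal (fun x => (a x : ℂ)) =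
        Matrix.diagonal (fun i => (r i : ℂ)) ⊗ₖ Matrix.diagonal (fun j => (s j : ℂ)) := by
      rw [Matrix.diagonal_kronecker_diagonal]
      simp [ha]
    rw [hdiag, Matrix.conjTranspose_kronecker, ← Matrix.mul_kronecker_mul,
      ← Matrix.mul_kronecker_mul, ← hρR, ← hσs]
  have hGτ : G * Matrix.diagonal (fun x => (a x : ℂ)) * Gᴴ =
      (R' ⊗ₖ Q)ᴴ * (U * (ρ ⊗ₖ σ) * Uᴴ) * (R' ⊗ₖ Q) := by
    rw [hrs, hGdef]
    simp only [Matrix.conjTranspose_mul, Matrix.conjTranspose_conjTranspose, mul_assoc]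
  have hsuma : ∑ x, Real.negMulLog (a x) = vN ρ + vN σ := by
    rw [hvσ]
    simp only [ha, Fintype.sum_prod_type, Real.negMulLog_mul, Finset.sum_add_distrib,
      ← Finset.sum_mul, ← Finset.mul_sum, hs1, hr, hρ.sum_eigs, one_mul, vN]
  have hprod := subadditivity_of_marginals hG (a := a) (p := p) (q := q)
    (fun x => mul_nonneg (hρ.eigs_nonneg _) (hs0 _)) hρ'.sum_eigs hσ'.sum_eigs
    (by
      rw [Fintype.sum_prod_type]
      simp only [ha, ← Finset.mul_sum, hs1, mul_one]
      exact hρ.sum_eigs)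
    (by
      rw [hGτ, ptrace2_kronecker_conj _ _ hQ, h1]
      conv_lhs => rw [hρR']
      simp only [mul_assoc, hR'1, mul_one]
      rw [← mul_assoc, hR'1, one_mul])
    (by
      rw [hGτ, ptrace1_kronecker_conj _ hR', h2]
      conv_lhs => rw [hσQ]
      simp only [mul_assoc, hQ1, mul_one]
      rw [← mul_assoc, hQ1, one_mul])
    (by
      rw [hsuma]
      change vN ρ' + vN σ' ≤ _
      linarith)
  have hmap := map_val_eq_of_unitary_diag_eq hG (one_mem _) (b := fun x => p x.1 * q x.2)
    (hprod.trans (by simp))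
  have hvN : vN ρ + vN σ = vN ρ' + vN σ' := by
    have h := congrArg (fun u : Multiset ℝ => (u.map Real.negMulLog).sum) hmap
    simp only [Multiset.map_map, Function.comp_def] at h
    change ∑ x, Real.negMulLog (a x) =
      ∑ x : Fin n × Fin m, Real.negMulLog (p x.1 * q x.2) at h
    rw [← hsuma, h]
    simp only [Fintype.sum_prod_type, Real.negMulLog_mul, Finset.sum_add_distrib,
      ← Finset.sum_mul, ← Finset.mul_sum, hp, hq, hρ'.sum_eigs, hσ'.sum_eigs, one_mul, vN]
  have hqs : Finset.univ.val.map q = Finset.univ.val.map s :=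
    map_val_eq_of_unitary_diag_eq hHmem (one_mem _) ((hdepheq (by linarith)).trans (by simp))
  have hspec : spectra ρ = spectra ρ' :=
    map_val_eq_of_map_mul_eq hs0 hs1 hqs.symm hmap
  exact ⟨hspec, exists_unitary_conj_of_spectra_eq hρ.1.isHermitian hρ'.1.isHermitian hspec⟩
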